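/- arXiv:1902.01455 — 11 statements merged into one kernel-verified Lean document; each statement's English description precedes it below -/
import Mathlib

section
/- Let σ be a real number, n ≥ 1, and let p_1, …, p_n : ℕ → ℝ^d satisfy p_i(k+1) = p_i(k) − σ Σ_{j=1}^n (p_i(k) − p_j(k)) for all i and k. Then for every i and k, p_i(k) = p̄(0) + (1 − σ n)^k (p_i(0) − p̄(0)). -/
open Finset

/-- Summing all relative displacements of the agents gives zero, so the dynamics conserve the
sum of the positions. -/
theorem S2_sum_eq_initial {ι E : Type*} [Fintype ι] [AddCommGroup E] [Module ℝ E] (σ : ℝ)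
    (p : ι → ℕ → E) (hdyn : ∀ i k, p i (k + 1) = p i k - σ • ∑ j, (p i k - p j k)) (k : ℕ) :
    ∑ j, p j k = ∑ j, p j 0 := by
  induction k with
  | zero => rfl
  | succ k ih =>
    have hzero : ∑ i, ∑ j, (p i k - p j k) = 0 := by
      simp [Finset.sum_sub_distrib, Finset.smul_sum]
    simp_rw [hdyn]
    rw [Finset.sum_sub_distrib, ← Finset.smul_sum, hzero, smul_zero, sub_zero, ih]

/-- System S2: full visibility, position sensing, discrete time.
Explicit solution `p_i(k) = p̄(0) + (1 - σn)^k (p_i(0) - p̄(0))`. -/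
theorem S2_explicit_solution {d n : ℕ} (hn : 1 ≤ n) (σ : ℝ)
    (p : Fin n → ℕ → EuclideanSpace ℝ (Fin d))
    (hdyn : ∀ i k, p i (k + 1) = p i k - σ • ∑ j, (p i k - p j k)) :
    ∀ i k, p i k = (n : ℝ)⁻¹ • ∑ j, p j 0
        + ((1 - σ * n) ^ k) • (p i 0 - (n : ℝ)⁻¹ • ∑ j, p j 0) := by
  have hn0 : (n : ℝ) ≠ 0 := by positivity
  intro i k
  induction k with
  | zero => simp
  | succ k ih =>
    have hsum : ∑ j, (p i k - p j k) = (n : ℝ) • p i k - ∑ j, p j 0 := by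
      rw [Finset.sum_sub_distrib, S2_sum_eq_initial σ p hdyn k]
      simp [Nat.cast_smul_eq_nsmul]
    rw [hdyn, hsum, ih]
    match_scalars <;> field_simp <;> ring
end

section
/- Let n ≥ 1 and 0 < σ < 2/n, and let p_1, …, p_n : ℕ → ℝ^d satisfy p_i(k+1) = p_i(k) − σ Σ_{j=1}^n (p_i(k) − p_j(k)) for all i and k. Then for every i, p_i(k) converges to p̄(0) as k → ∞. -/
open Finset Filter

/-- The sum of the positions is invariant under the linear gathering law. -/
theorem sum_eq_sum_zero_of_gathering {ι E : Type*} [Fintype ι] [AddCommGroup E] [Module ℝ E]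
    {σ : ℝ} {p : ι → ℕ → E}
    (hdyn : ∀ i k, p i (k + 1) = p i k - σ • ∑ j, (p i k - p j k)) (k : ℕ) :
    ∑ i, p i k = ∑ i, p i 0 := by
  induction k with
  | zero => rfl
  | succ k ih =>
    simp only [hdyn, sum_sub_distrib, ← smul_sum, sum_const, ih, sub_self, smul_zero, sub_zero]

/-- Under the linear gathering law, the deviation of each agent from the initial average is
multiplied by `1 - σ n` at each step, where `n` is the number of agents. -/
theorem sub_average_eq_pow_smul_of_gathering {ι E : Type*} [Fintype ι] [Nonempty ι]
    [AddCommGroup E] [Module ℝ E] {σ : ℝ} {p : ι → ℕ → E}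
    (hdyn : ∀ i k, p i (k + 1) = p i k - σ • ∑ j, (p i k - p j k)) (i : ι) (k : ℕ) :
    p i k - (Fintype.card ι : ℝ)⁻¹ • ∑ j, p j 0 =
      (1 - σ * Fintype.card ι) ^ k • (p i 0 - (Fintype.card ι : ℝ)⁻¹ • ∑ j, p j 0) := by
  induction k with
  | zero => simp
  | succ k ih =>
    have hcard : (Fintype.card ι : ℝ) ≠ 0 := Nat.cast_ne_zero.mpr Fintype.card_ne_zero
    rw [pow_succ', mul_smul, ← ih, hdyn, sum_sub_distrib, sum_eq_sum_zero_of_gathering hdyn k,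
      sum_const, card_univ, ← Nat.cast_smul_eq_nsmul ℝ]
    match_scalars <;> field_simp
    ring

/-- System S2 converges to the average of the initial constellation whenever
`0 < σ < 2/n`. -/
theorem S2_convergence {d n : ℕ} (hn : 1 ≤ n) (σ : ℝ)
    (hσ1 : 0 < σ) (hσ2 : σ < 2 / n)
    (p : Fin n → ℕ → EuclideanSpace ℝ (Fin d))
    (hdyn : ∀ i k, p i (k + 1) = p i k - σ • ∑ j, (p i k - p j k)) :
    ∀ i, Tendsto (fun k => p i k) atTop (nhds ((n : ℝ)⁻¹ • ∑ j, p j 0)) := by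
  intro i
  have : Nonempty (Fin n) := ⟨i⟩
  have hn0 : (0 : ℝ) < n := by exact_mod_cast hn
  have hpos : 0 < σ * n := mul_pos hσ1 hn0
  have hlt : σ * n < 2 := (lt_div_iff₀ hn0).mp hσ2
  have hpow : Tendsto (fun k : ℕ => (1 - σ * n) ^ k) atTop (nhds 0) :=
    tendsto_pow_atTop_nhds_zero_of_abs_lt_one (abs_lt.mpr ⟨by linarith, by linarith⟩)
  rw [← tendsto_sub_nhds_zero_iff]
  have hdev := sub_average_eq_pow_smul_of_gathering hdyn i
  simp only [Fintype.card_fin] at hdev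
  rw [funext hdev]
  simpa using hpow.smul_const (p i 0 - (n : ℝ)⁻¹ • ∑ j, p j 0)
end

section
/- Let n ≥ 1 and σ > 2/n, and let p_1, …, p_n : ℕ → ℝ^d satisfy p_i(k+1) = p_i(k) − σ Σ_{j=1}^n (p_i(k) − p_j(k)) for all i and k. If p_i(0) ≠ p̄(0) for some index i, then ‖p_i(k) − p̄(0)‖ → ∞ as k → ∞, i.e. the system diverges. -/
open Finset Filter

/-- The linear gathering law preserves the sum of the positions. -/
theorem sum_position_eq_of_gathering {ι E : Type*} [Fintype ι] [AddCommGroup E] [Module ℝ E]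
    (σ : ℝ) (p : ι → ℕ → E)
    (hdyn : ∀ i k, p i (k + 1) = p i k - σ • ∑ j, (p i k - p j k)) (k : ℕ) :
    ∑ i, p i k = ∑ i, p i 0 := by
  induction k with
  | zero => rfl
  | succ k ih =>
    rw [← ih]
    simp [hdyn, sum_sub_distrib, ← smul_sum]

/-- Under the linear gathering law, each deviation from the initial average is multiplied by
`1 - σ * n` at every step. -/
theorem deviation_eq_pow_smul_of_gathering {ι E : Type*} [Fintype ι] [Nonempty ι]
    [AddCommGroup E] [Module ℝ E] (σ : ℝ) (p : ι → ℕ → E)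
    (hdyn : ∀ i k, p i (k + 1) = p i k - σ • ∑ j, (p i k - p j k)) (i : ι) (k : ℕ) :
    p i k - (Fintype.card ι : ℝ)⁻¹ • ∑ j, p j 0 =
      (1 - σ * Fintype.card ι) ^ k • (p i 0 - (Fintype.card ι : ℝ)⁻¹ • ∑ j, p j 0) := by
  have hcard : (Fintype.card ι : ℝ) ≠ 0 := by simp
  induction k with
  | zero => simp
  | succ k ih =>
    rw [pow_succ', mul_smul, ← ih, hdyn, sum_sub_distrib, sum_position_eq_of_gathering σ p hdyn k,
      sum_const, card_univ, ← Nat.cast_smul_eq_nsmul ℝ]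
    match_scalars <;> field_simp
    ring

/-- System S2 diverges when `σ > 2/n`: any agent that does not start at the
average position escapes to infinity. -/
theorem S2_divergence {d n : ℕ} (hn : 1 ≤ n) (σ : ℝ) (hσ : 2 / n < σ)
    (p : Fin n → ℕ → EuclideanSpace ℝ (Fin d))
    (hdyn : ∀ i k, p i (k + 1) = p i k - σ • ∑ j, (p i k - p j k)) :
    ∀ i, p i 0 ≠ (n : ℝ)⁻¹ • ∑ j, p j 0 →
      Tendsto (fun k => ‖p i k - (n : ℝ)⁻¹ • ∑ j, p j 0‖) atTop atTop := by
  intro i hi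
  have : Nonempty (Fin n) := ⟨i⟩
  have hdev := deviation_eq_pow_smul_of_gathering σ p hdyn i
  simp only [Fintype.card_fin] at hdev
  have hn_pos : (0 : ℝ) < n := by exact_mod_cast hn
  have hfactor : 1 < |1 - σ * n| := by
    rw [div_lt_iff₀ hn_pos] at hσ
    rw [lt_abs]
    right
    linarith
  refine ((tendsto_pow_atTop_atTop_of_one_lt hfactor).atTop_mul_const
    (norm_pos_iff.mpr (sub_ne_zero.mpr hi))).congr fun k => ?_
  rw [hdev k, norm_smul, norm_pow, Real.norm_eq_abs]
end

section
/- Let G be a connected simple graph on the vertex set Fin n (n ≥ 1) with graph Laplacian matrix L = Δ(G) − A(G), let σ > 0, and let p_1, …, p_n : ℝ → ℝ^d be differentiable trajectories satisfying ṗ_i(t) = −σ Σ_{j ∈ N_G(i)} (p_i(t) − p_j(t)) for all i and t (equivalently, Ṗ(t) = −σ L P(t) componentwise). Then for every i, p_i(t) converges as t → ∞ to the average (1/n) Σ_{j=1}^n p_j(0) of the initial positions. -/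
open Finset Filter

namespace SimpleGraph

variable {V E : Type*} [Fintype V] (G : SimpleGraph V) [DecidableRel G.Adj]

theorem sum_sum_neighborFinset_swap {M : Type*} [AddCommMonoid M] (f : V → V → M) :
    ∑ i, ∑ j ∈ G.neighborFinset i, f i j = ∑ i, ∑ j ∈ G.neighborFinset i, f j i :=
  Finset.sum_comm' fun i j => by simp [G.adj_comm]

theorem sum_sum_neighborFinset_sub_eq_zero [AddCommGroup E] (q : V → E) :
    ∑ i, ∑ j ∈ G.neighborFinset i, (q i - q j) = 0 := by
  simp only [Finset.sum_sub_distrib]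
  rw [G.sum_sum_neighborFinset_swap fun i _ => q i, sub_self]

section Energy

variable [NormedAddCommGroup E]

/-- The Dirichlet energy of a vertex labelling; each edge is counted in both directions. -/
def dirichletEnergy (q : V → E) : ℝ :=
  ∑ i, ∑ j ∈ G.neighborFinset i, ‖q i - q j‖ ^ 2

theorem dirichletEnergy_nonneg (q : V → E) : 0 ≤ G.dirichletEnergy q := by
  unfold dirichletEnergy
  positivity

variable {G}

theorem Adj.norm_sub_le_sqrt_dirichletEnergy {u v : V} (h : G.Adj u v) (q : V → E) :
    ‖q u - q v‖ ≤ √(G.dirichletEnergy q) := by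
  refine Real.le_sqrt_of_sq_le ?_
  calc ‖q u - q v‖ ^ 2
      ≤ ∑ j ∈ G.neighborFinset u, ‖q u - q j‖ ^ 2 :=
        Finset.single_le_sum (f := fun j => ‖q u - q j‖ ^ 2) (fun _ _ => sq_nonneg _)
          ((G.mem_neighborFinset u v).2 h)
    _ ≤ G.dirichletEnergy q :=
        Finset.single_le_sum (f := fun i => ∑ j ∈ G.neighborFinset i, ‖q i - q j‖ ^ 2)
          (fun _ _ => Finset.sum_nonneg fun _ _ => sq_nonneg _) (Finset.mem_univ u)

theorem Walk.norm_sub_le_length_mul_sqrt_dirichletEnergy {u v : V} (w : G.Walk u v)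
    (q : V → E) : ‖q u - q v‖ ≤ w.length * √(G.dirichletEnergy q) := by
  induction w with
  | nil => simp
  | @cons a b c h w ih =>
    have h₁ := h.norm_sub_le_sqrt_dirichletEnergy q
    have h₂ := norm_sub_le_norm_sub_add_norm_sub (q a) (q b) (q c)
    rw [Walk.length_cons]
    push_cast
    linarith

/-- A Poincaré inequality on a finite connected graph. -/
theorem Connected.exists_sum_norm_sq_le_dirichletEnergy [NormedSpace ℝ E]
    (hG : G.Connected) :
    ∃ C : ℝ, 0 < C ∧ ∀ q : V → E, ∑ i, q i = 0 →
      ∑ i, ‖q i‖ ^ 2 ≤ C * G.dirichletEnergy q := by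
  refine ⟨∑ i, (∑ j, (G.dist i j : ℝ)) ^ 2 + 1, by positivity, fun q hq => ?_⟩
  have := hG.nonempty
  have hbound (i : V) : ‖q i‖ ≤ (∑ j, (G.dist i j : ℝ)) * √(G.dirichletEnergy q) := by
    have hcard : (1 : ℝ) ≤ Fintype.card V := by exact_mod_cast Fintype.card_pos
    calc ‖q i‖ ≤ Fintype.card V * ‖q i‖ := le_mul_of_one_le_left (norm_nonneg _) hcard
      _ = ‖∑ j, (q i - q j)‖ := by
        simp [Finset.sum_sub_distrib, hq, ← Nat.cast_smul_eq_nsmul ℝ, norm_smul]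
      _ ≤ ∑ j, ‖q i - q j‖ := norm_sum_le _ _
      _ ≤ ∑ j, (G.dist i j : ℝ) * √(G.dirichletEnergy q) := by
        refine Finset.sum_le_sum fun j _ => ?_
        obtain ⟨w, hw⟩ := hG.exists_walk_length_eq_dist i j
        exact hw ▸ w.norm_sub_le_length_mul_sqrt_dirichletEnergy q
      _ = _ := (Finset.sum_mul ..).symm
  calc ∑ i, ‖q i‖ ^ 2
      ≤ ∑ i, (∑ j, (G.dist i j : ℝ)) ^ 2 * G.dirichletEnergy q := by
        refine Finset.sum_le_sum fun i _ => ?_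
        have := pow_le_pow_left₀ (norm_nonneg _) (hbound i) 2
        rwa [mul_pow, Real.sq_sqrt (G.dirichletEnergy_nonneg q)] at this
    _ ≤ _ := by
        rw [← Finset.sum_mul]
        gcongr
        · exact G.dirichletEnergy_nonneg q
        · exact le_add_of_nonneg_right zero_le_one

end Energy

theorem two_mul_sum_inner_sum_sub_eq_dirichletEnergy [NormedAddCommGroup E]
    [InnerProductSpace ℝ E] (q : V → E) :
    2 * ∑ i, inner ℝ (q i) (∑ j ∈ G.neighborFinset i, (q i - q j)) = G.dirichletEnergy q := by
  have hswap := G.sum_sum_neighborFinset_swap fun i j => inner ℝ (q i) (q i - q j)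
  simp only [inner_sum]
  rw [two_mul]
  nth_rw 2 [hswap]
  simp only [← Finset.sum_add_distrib, dirichletEnergy]
  refine Finset.sum_congr rfl fun i _ => Finset.sum_congr rfl fun j _ => ?_
  rw [← real_inner_self_eq_norm_sq, inner_sub_left, ← neg_sub (q i) (q j), inner_neg_right]
  ring

end SimpleGraph

/-- A nonnegative function satisfying `f' ≤ -k f` with `k > 0` tends to zero. -/
theorem tendsto_zero_of_hasDerivAt_le_neg_mul {f f' : ℝ → ℝ} {k : ℝ} (hk : 0 < k)
    (hf : ∀ t, HasDerivAt f (f' t) t) (hnonneg : ∀ t, 0 ≤ f t)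
    (hle : ∀ t, f' t ≤ -k * f t) : Tendsto f atTop (nhds 0) := by
  have hderiv (t : ℝ) : HasDerivAt (fun s => Real.exp (k * s) * f s)
      (Real.exp (k * t) * (k * f t + f' t)) t := by
    have := (((hasDerivAt_id t).const_mul k).exp).mul (hf t)
    refine this.congr_deriv ?_
    simp only [id]
    ring
  have hanti : Antitone fun s => Real.exp (k * s) * f s := by
    refine antitone_of_deriv_nonpos (fun t => (hderiv t).differentiableAt) fun t => ?_
    rw [(hderiv t).deriv]
    exact mul_nonpos_of_nonneg_of_nonpos (Real.exp_pos _).le (by linarith [hle t])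
  have hexp : Tendsto (fun t => Real.exp (-(k * t)) * f 0) atTop (nhds 0) := by
    simpa using (Real.tendsto_exp_neg_atTop_nhds_zero.comp
      (tendsto_id.const_mul_atTop hk)).mul_const (f 0)
  refine tendsto_of_tendsto_of_tendsto_of_le_of_le' tendsto_const_nhds hexp
    (Eventually.of_forall hnonneg) ?_
  filter_upwards [eventually_ge_atTop 0] with t ht
  have := hanti ht
  simp only [mul_zero, Real.exp_zero, one_mul] at this
  rwa [Real.exp_neg, ← div_eq_inv_mul, le_div_iff₀' (Real.exp_pos _)]

/-- Continuous-time linear consensus over a fixed connected interaction graph: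
all agents converge to the average of the initial positions. -/
theorem laplacian_consensus_continuous {d n : ℕ} (hn : 1 ≤ n)
    (G : SimpleGraph (Fin n)) [DecidableRel G.Adj] (hG : G.Connected)
    (σ : ℝ) (hσ : 0 < σ)
    (p : Fin n → ℝ → EuclideanSpace ℝ (Fin d))
    (hdyn : ∀ i t, HasDerivAt (p i)
      ((-σ) • ∑ j ∈ G.neighborFinset i, (p i t - p j t)) t) :
    ∀ i, Tendsto (fun t => p i t) atTop (nhds ((n : ℝ)⁻¹ • ∑ j, p j 0)) := by
  have hsum (t : ℝ) : ∑ i, p i t = ∑ i, p i 0 := by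
    have hderiv (s : ℝ) : HasDerivAt (fun s => ∑ i, p i s) 0 s := by
      refine (HasDerivAt.fun_sum fun i _ => hdyn i s).congr_deriv ?_
      rw [← Finset.smul_sum, G.sum_sum_neighborFinset_sub_eq_zero fun i => p i s, smul_zero]
    exact is_const_of_deriv_eq_zero (fun s => (hderiv s).differentiableAt)
      (fun s => (hderiv s).deriv) t 0
  set c := (n : ℝ)⁻¹ • ∑ j, p j 0 with hc
  obtain ⟨C, hC, hpoincare⟩ :=
    hG.exists_sum_norm_sq_le_dirichletEnergy (E := EuclideanSpace ℝ (Fin d))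
  have hcentered (t : ℝ) : ∑ i, (p i t - c) = 0 := by
    have hn' : (n : ℝ) ≠ 0 := by exact_mod_cast (by omega : n ≠ 0)
    simp [Finset.sum_sub_distrib, hsum, hc, ← Nat.cast_smul_eq_nsmul ℝ, smul_smul, hn']
  have hderiv (t : ℝ) : HasDerivAt (fun t => ∑ i, ‖p i t - c‖ ^ 2)
      (-σ * G.dirichletEnergy fun i => p i t - c) t := by
    refine (HasDerivAt.fun_sum fun i _ => ((hdyn i t).sub_const c).norm_sq).congr_deriv ?_
    rw [← G.two_mul_sum_inner_sum_sub_eq_dirichletEnergy]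
    simp only [sub_sub_sub_cancel_right, inner_smul_right, Finset.mul_sum]
    exact Finset.sum_congr rfl fun i _ => by ring
  have hlim := tendsto_zero_of_hasDerivAt_le_neg_mul (div_pos hσ hC) hderiv
    (fun t => Finset.sum_nonneg fun _ _ => sq_nonneg _) fun t => by
      have := mul_le_mul_of_nonneg_left (hpoincare _ (hcentered t)) (div_pos hσ hC).le
      rw [← mul_assoc, div_mul_cancel₀ σ hC.ne'] at this
      linarith
  intro i
  rw [tendsto_iff_norm_sub_tendsto_zero]
  have hsq : Tendsto (fun t => ‖p i t - c‖ ^ 2) atTop (nhds 0) :=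
    squeeze_zero (fun _ => sq_nonneg _) (fun t =>
      Finset.single_le_sum (f := fun i => ‖p i t - c‖ ^ 2) (fun _ _ => sq_nonneg _)
        (Finset.mem_univ i)) hlim
  simpa [Real.sqrt_sq] using hsq.sqrt
end

section
/- Let G be a connected simple graph on the vertex set Fin n (n ≥ 1) with graph Laplacian matrix L = Δ(G) − A(G), and let σ > 0 be such that |1 − σλ| < 1 for every nonzero eigenvalue λ of L. Let p_1, …, p_n : ℕ → ℝ^d satisfy p_i(k+1) = p_i(k) − σ Σ_{j ∈ N_G(i)} (p_i(k) − p_j(k)) for all i and k (equivalently, P(k+1) = (I − σL) P(k) componentwise). Then for every i, p_i(k) converges as k → ∞ to the average (1/n) Σ_{j=1}^n p_j(0) of the initial positions. -/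
open Finset Filter

/-- The iteration `x ↦ x - σ A x` of a real symmetric matrix `A` converges whenever
`|1 - σμ| < 1` for every nonzero eigenvalue `μ` of `A`. -/
theorem Matrix.IsHermitian.exists_tendsto_iterate_sub_smul_mulVec {ι : Type*} [Fintype ι]
    {A : Matrix ι ι ℝ} (hA : A.IsHermitian) {σ : ℝ}
    (heig : ∀ μ : ℝ, μ ≠ 0 → (∃ v : ι → ℝ, v ≠ 0 ∧ A.mulVec v = μ • v) → |1 - σ * μ| < 1)
    {x : ℕ → ι → ℝ} (hx : ∀ k, x (k + 1) = x k - σ • A.mulVec (x k)) :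
    ∃ y, Tendsto x atTop (nhds y) := by
  classical
  set b : ι → ι → ℝ := fun j => (hA.eigenvectorBasis j).ofLp with hb
  have hAb (j) : A.mulVec (b j) = hA.eigenvalues j • b j := hA.mulVec_eigenvectorBasis j
  have hb0 (j) : b j ≠ 0 := fun h =>
    hA.eigenvectorBasis.orthonormal.ne_zero j (by ext i; exact congrFun h i)
  obtain ⟨c, hc⟩ : ∃ c : ι → ℝ, x 0 = ∑ j, c j • b j := by
    refine ⟨fun j => hA.eigenvectorBasis.repr (WithLp.toLp 2 (x 0)) j, ?_⟩
    have h := congrArg WithLp.ofLp (hA.eigenvectorBasis.sum_repr (WithLp.toLp 2 (x 0)))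
    simpa [hb] using h.symm
  have hclosed (k) : x k = ∑ j, (1 - σ * hA.eigenvalues j) ^ k • c j • b j := by
    induction k with
    | zero => simpa using hc
    | succ k ih =>
      rw [hx, ih, Matrix.mulVec_sum, Finset.smul_sum, ← Finset.sum_sub_distrib]
      refine Finset.sum_congr rfl fun j _ => ?_
      rw [Matrix.mulVec_smul, Matrix.mulVec_smul, hAb]
      module
  have hterm (j) : ∃ a, Tendsto (fun k : ℕ => (1 - σ * hA.eigenvalues j) ^ k) atTop (nhds a) := by
    by_cases h : hA.eigenvalues j = 0
    · exact ⟨1, by simp [h]⟩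
    · exact ⟨0, tendsto_pow_atTop_nhds_zero_of_abs_lt_one (heig _ h ⟨b j, hb0 j, hAb j⟩)⟩
  choose a ha using hterm
  refine ⟨∑ j, a j • c j • b j, ?_⟩
  rw [funext hclosed]
  exact tendsto_finsetSum _ fun j _ => (ha j).smul_const _

theorem SimpleGraph.sum_lapMatrix_mulVec {V R : Type*} [Fintype V] [DecidableEq V] [CommRing R]
    (G : SimpleGraph V) [DecidableRel G.Adj] (v : V → R) :
    ∑ i, (G.lapMatrix R).mulVec v i = 0 := by
  have h : (1 : V → R) ⬝ᵥ (G.lapMatrix R).mulVec v = 0 := by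
    rw [Matrix.dotProduct_mulVec, ← Matrix.mulVec_transpose, (G.isSymm_lapMatrix (R := R)).eq]
    have h1 : (G.lapMatrix R).mulVec (1 : V → R) = 0 := G.lapMatrix_mulVec_const_eq_zero
    rw [h1, zero_dotProduct]
  simpa [dotProduct] using h

/-- Scalar linear consensus: the iteration `x ↦ x - σ L x` of the Laplacian `L` of a connected
graph converges to the average of the initial values. -/
theorem SimpleGraph.Connected.tendsto_lapMatrix_consensus {V : Type*} [Fintype V] [DecidableEq V]
    {G : SimpleGraph V} [DecidableRel G.Adj] (hG : G.Connected) {σ : ℝ} (hσ : σ ≠ 0)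
    (heig : ∀ μ : ℝ, μ ≠ 0 →
      (∃ v : V → ℝ, v ≠ 0 ∧ (G.lapMatrix ℝ).mulVec v = μ • v) → |1 - σ * μ| < 1)
    {x : ℕ → V → ℝ} (hx : ∀ k, x (k + 1) = x k - σ • (G.lapMatrix ℝ).mulVec (x k)) (i : V) :
    Tendsto (fun k => x k i) atTop (nhds ((Fintype.card V : ℝ)⁻¹ * ∑ j, x 0 j)) := by
  obtain ⟨y, hy⟩ :=
    (G.isHermitian_lapMatrix (R := ℝ)).exists_tendsto_iterate_sub_smul_mulVec heig hx
  have hy' (j) : Tendsto (fun k => x k j) atTop (nhds (y j)) := tendsto_pi_nhds.1 hy j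
  have hLy : (G.lapMatrix ℝ).mulVec y = 0 := by
    have hcont : Continuous fun v : V → ℝ => v - σ • (G.lapMatrix ℝ).mulVec v := by fun_prop
    have h1 := (hcont.tendsto y).comp hy
    have h2 := (tendsto_add_atTop_iff_nat 1).2 hy
    rw [funext hx] at h2
    have h3 := tendsto_nhds_unique h1 h2
    simpa [hσ] using h3
  have hconst (j) : y j = y i :=
    (G.lapMatrix_mulVec_eq_zero_iff_forall_reachable.1 hLy) j i (hG.preconnected j i)
  have hsum (k) : ∑ j, x k j = ∑ j, x 0 j := by
    induction k with
    | zero => rfl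
    | succ k ih =>
      rw [← ih, hx]
      simp [Finset.sum_sub_distrib, ← Finset.mul_sum, G.sum_lapMatrix_mulVec]
  have hlim : ∑ j, y j = ∑ j, x 0 j := by
    have h := tendsto_finsetSum univ fun j _ => hy' j
    simp only [hsum] at h
    exact tendsto_nhds_unique h tendsto_const_nhds
  have : Nonempty V := ⟨i⟩
  rw [← hlim, Finset.sum_congr rfl fun j _ => hconst j, Finset.sum_const, Finset.card_univ,
    nsmul_eq_mul, inv_mul_cancel_left₀ (by simp)]
  exact hy' i

/-- Discrete-time linear consensus over a fixed connected interaction graph: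
if `|1 - σλ| < 1` for every nonzero eigenvalue `λ` of the graph Laplacian,
all agents converge to the average of the initial positions. -/
theorem laplacian_consensus_discrete {d n : ℕ} (hn : 1 ≤ n)
    (G : SimpleGraph (Fin n)) [DecidableRel G.Adj] (hG : G.Connected)
    (σ : ℝ) (hσ : 0 < σ)
    (heig : ∀ μ : ℝ, μ ≠ 0 →
      (∃ v : Fin n → ℝ, v ≠ 0 ∧ (G.lapMatrix ℝ).mulVec v = μ • v) →
      |1 - σ * μ| < 1)
    (p : Fin n → ℕ → EuclideanSpace ℝ (Fin d))
    (hdyn : ∀ i k, p i (k + 1) = p i k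
      - σ • ∑ j ∈ G.neighborFinset i, (p i k - p j k)) :
    ∀ i, Tendsto (fun k => p i k) atTop (nhds ((n : ℝ)⁻¹ • ∑ j, p j 0)) := by
  intro i
  have hcoord (l : Fin d) := hG.tendsto_lapMatrix_consensus hσ.ne' heig
    (x := fun k j => p j k l) (fun k => by
      ext j
      simp [hdyn, SimpleGraph.lapMatrix_mulVec_apply, Finset.sum_sub_distrib]) i
  have h : Tendsto (fun k => (p i k).ofLp) atTop
      (nhds ((n : ℝ)⁻¹ • ∑ j, p j 0 : EuclideanSpace ℝ (Fin d)).ofLp) :=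
    tendsto_pi_nhds.2 fun l => by simpa using hcoord l
  exact ((PiLp.continuous_toLp 2 _).tendsto _).comp h
end

section
/- Let G be a simple graph on the vertex set Fin n, σ a real number, and let p_1, …, p_n : ℝ → ℝ^d be differentiable trajectories satisfying ṗ_i(t) = −σ Σ_{j ∈ N_G(i)} (p_i(t) − p_j(t)) for all i and t. Then the function t ↦ Σ_{i=1}^n ‖p_i(t)‖² is differentiable with derivative (d/dt) Σ_{i=1}^n ‖p_i(t)‖² = −σ Σ_{i=1}^n Σ_{j ∈ N_G(i)} ‖p_i(t) − p_j(t)‖² at every t. -/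
open Finset

/-- A sum over the ordered pairs of adjacent vertices is invariant under swapping the two ends. -/
lemma SimpleGraph.sum_sum_neighborFinset_comm {V M : Type*} [Fintype V] [AddCommMonoid M]
    (G : SimpleGraph V) [DecidableRel G.Adj] (f : V → V → M) :
    ∑ i, ∑ j ∈ G.neighborFinset i, f i j = ∑ i, ∑ j ∈ G.neighborFinset i, f j i :=
  Finset.sum_comm' fun i j => by simp [G.adj_comm]

/-- The quadratic form of the graph Laplacian on vectors of an inner product space. -/
lemma SimpleGraph.two_mul_sum_inner_sum_sub {V E : Type*} [Fintype V]
    [NormedAddCommGroup E] [InnerProductSpace ℝ E]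
    (G : SimpleGraph V) [DecidableRel G.Adj] (x : V → E) :
    2 * ∑ i, inner ℝ (x i) (∑ j ∈ G.neighborFinset i, (x i - x j)) =
      ∑ i, ∑ j ∈ G.neighborFinset i, ‖x i - x j‖ ^ 2 := by
  simp_rw [inner_sum]
  rw [two_mul]
  nth_rewrite 2 [G.sum_sum_neighborFinset_comm]
  simp_rw [← Finset.sum_add_distrib]
  refine Finset.sum_congr rfl fun i _ => Finset.sum_congr rfl fun j _ => ?_
  rw [← real_inner_self_eq_norm_sq, inner_sub_left (x i) (x j), ← neg_sub (x i) (x j),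
    inner_neg_right, ← sub_eq_add_neg]

/-- Lyapunov computation: under the Laplacian dynamics the sum of squared
norms of the positions decreases with derivative
`-σ Σ_i Σ_{j ∈ N_i} ‖p_i - p_j‖²`. -/
theorem lyapunov_derivative {d n : ℕ}
    (G : SimpleGraph (Fin n)) [DecidableRel G.Adj] (σ : ℝ)
    (p : Fin n → ℝ → EuclideanSpace ℝ (Fin d))
    (hdyn : ∀ i t, HasDerivAt (p i)
      ((-σ) • ∑ j ∈ G.neighborFinset i, (p i t - p j t)) t) :
    ∀ t : ℝ, HasDerivAt (fun s => ∑ i, ‖p i s‖ ^ 2)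
      (-σ * ∑ i, ∑ j ∈ G.neighborFinset i, ‖p i t - p j t‖ ^ 2) t := by
  intro t
  refine (HasDerivAt.fun_sum fun i (_ : i ∈ Finset.univ) => (hdyn i t).norm_sq).congr_deriv ?_
  rw [← G.two_mul_sum_inner_sum_sub fun i => p i t]
  simp_rw [inner_smul_right, Finset.mul_sum]
  exact Finset.sum_congr rfl fun i _ => by ring
end

section
/- Let n ≥ 1, 0 < σ < 1/n, and let χ_1, …, χ_n ∈ {0,1} be arbitrary activation indicators. Given points p_1, …, p_n ∈ ℝ^d, define q_i = p_i − σ χ_i Σ_{j=1}^n (p_i − p_j) for each i, and let p̄ and q̄ be the averages of the p_i and the q_i respectively. Then Σ_{i=1}^n ‖q_i − q̄‖ ≤ Σ_{i=1}^n ‖p_i − p̄‖, i.e. one semi-synchronous step of the linear gathering law never increases the sum of distances of the agents to their average position. -/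
open Finset

/-- One semi-synchronous step of the linear gathering law (gain `0 < σ < 1/n`,
arbitrary activation indicators `χ_i ∈ {0,1}`) never increases the sum of the
distances of the agents to their average position. -/
theorem semi_synchronous_step_monotone {d n : ℕ} (hn : 1 ≤ n)
    (σ : ℝ) (hσ1 : 0 < σ) (hσ2 : σ < 1 / n)
    (χ : Fin n → ℝ) (hχ : ∀ i, χ i = 0 ∨ χ i = 1)
    (p q : Fin n → EuclideanSpace ℝ (Fin d))
    (hq : ∀ i, q i = p i - (σ * χ i) • ∑ j, (p i - p j)) :
    ∑ i, ‖q i - (n : ℝ)⁻¹ • ∑ j, q j‖ ≤ ∑ i, ‖p i - (n : ℝ)⁻¹ • ∑ j, p j‖ := by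
  have hn0 : (0 : ℝ) < n := by exact_mod_cast hn
  have hσn : σ * n < 1 := (lt_div_iff₀ hn0).mp hσ2
  set c : EuclideanSpace ℝ (Fin d) := (n : ℝ)⁻¹ • ∑ j, p j with hc
  have hsum (i : Fin n) : ∑ j, (p i - p j) = (n : ℝ) • (p i - c) := by
    rw [sum_sub_distrib, sum_const, card_univ, Fintype.card_fin, hc, smul_sub,
      smul_inv_smul₀ hn0.ne', Nat.cast_smul_eq_nsmul]
  have hqi (i : Fin n) : q i = p i - (σ * χ i * n) • (p i - c) := by
    rw [hq i, hsum i, smul_smul]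
  have hmove (i : Fin n) : ‖q i - c‖ = (1 - σ * χ i * n) * ‖p i - c‖ := by
    have h : q i - c = (1 - σ * χ i * n) • (p i - c) := by
      rw [hqi i, sub_smul, one_smul]
      abel
    have h0 : 0 ≤ 1 - σ * χ i * n := by
      rcases hχ i with h | h <;> rw [h] <;> linarith
    rw [h, norm_smul, Real.norm_of_nonneg h0]
  have hmean : c - (n : ℝ)⁻¹ • ∑ j, q j = ∑ j, (σ * χ j) • (p j - c) := by
    rw [hc, ← smul_sub, ← sum_sub_distrib, ← hc, smul_sum]
    refine sum_congr rfl fun j _ => ?_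
    rw [hqi j, sub_sub_cancel, smul_smul]
    congr 1
    field_simp
  have hdrift : ‖c - (n : ℝ)⁻¹ • ∑ j, q j‖ ≤ ∑ j, σ * χ j * ‖p j - c‖ := by
    rw [hmean]
    refine norm_sum_le_of_le _ fun j _ => ?_
    have h0 : 0 ≤ σ * χ j := by
      rcases hχ j with h | h <;> rw [h] <;> linarith
    rw [norm_smul, Real.norm_of_nonneg h0]
  calc ∑ i, ‖q i - (n : ℝ)⁻¹ • ∑ j, q j‖
      ≤ ∑ i, ((1 - σ * χ i * n) * ‖p i - c‖ + ∑ j, σ * χ j * ‖p j - c‖) := by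
        refine sum_le_sum fun i _ => ?_
        rw [← hmove i]
        exact (norm_sub_le_norm_sub_add_norm_sub _ c _).trans (by gcongr)
    _ = ∑ i, ‖p i - c‖ := by
        rw [sum_add_distrib, sum_const, card_univ, Fintype.card_fin, nsmul_eq_mul, mul_sum,
          ← sum_add_distrib]
        exact sum_congr rfl fun i _ => by ring
end

section
/- Let p_1, …, p_n be points in ℝ^d with n ≥ 2 and Σ_{j=1}^n p_j = 0. Let m be an index with ‖p_m‖ = max_i ‖p_i‖, assume ‖p_m‖ > 0, and assume p_j ≠ p_m for every j ≠ m. Then Σ_{j ≠ m} ⟨ p_m/‖p_m‖ , (p_m − p_j)/‖p_m − p_j‖ ⟩ ≥ n/2; that is, the sum over the other agents of the projections onto the direction of p_m of the unit vectors pointing from p_j to p_m is at least n/2. -/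
open Finset
open scoped RealInnerProductSpace

/-- For points with zero average, the sum over the other agents of the
projections onto the direction of a farthest point `p_m` of the unit vectors
pointing from `p_j` to `p_m` is at least `n/2`. -/
theorem farthest_agent_projection_bound {d n : ℕ} (hn : 2 ≤ n)
    (p : Fin n → EuclideanSpace ℝ (Fin d))
    (hsum : ∑ j, p j = 0)
    (m : Fin n) (hmax : ∀ i, ‖p i‖ ≤ ‖p m‖) (hm : 0 < ‖p m‖)
    (hne : ∀ j, j ≠ m → p j ≠ p m) :
    (n : ℝ) / 2 ≤ ∑ j ∈ Finset.univ.erase m,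
      ⟪(‖p m‖)⁻¹ • p m, (‖p m - p j‖)⁻¹ • (p m - p j)⟫ := by
  have hterm : ∀ j ∈ Finset.univ.erase m,
      (1 - ⟪p m, p j⟫ / ‖p m‖ ^ 2) / 2 ≤
        ⟪(‖p m‖)⁻¹ • p m, (‖p m - p j‖)⁻¹ • (p m - p j)⟫ := by
    intro j hj
    have hD : 0 < ‖p m - p j‖ :=
      norm_pos_iff.mpr (sub_ne_zero.mpr (hne j (Finset.ne_of_mem_erase hj)).symm)
    have hD2 : ‖p m - p j‖ ≤ 2 * ‖p m‖ := by
      linarith [norm_sub_le (p m) (p j), hmax j]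
    have ha : 0 ≤ ‖p m‖ ^ 2 - ⟪p m, p j⟫ := by
      nlinarith [real_inner_le_norm (p m) (p j), hmax j]
    rw [real_inner_smul_left, real_inner_smul_right, inner_sub_right,
      real_inner_self_eq_norm_sq]
    calc (1 - ⟪p m, p j⟫ / ‖p m‖ ^ 2) / 2
        = (‖p m‖ ^ 2 - ⟪p m, p j⟫) / (‖p m‖ * (2 * ‖p m‖)) := by
          field_simp
      _ ≤ (‖p m‖ ^ 2 - ⟪p m, p j⟫) / (‖p m‖ * ‖p m - p j‖) := by
          gcongr
      _ = _ := by field_simp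
  refine le_trans (le_of_eq ?_) (Finset.sum_le_sum hterm)
  have hzero : (1 - ⟪p m, p m⟫ / ‖p m‖ ^ 2) / 2 = 0 := by
    rw [real_inner_self_eq_norm_sq, div_self (by positivity)]
    norm_num
  rw [Finset.sum_erase (f := fun j => (1 - ⟪p m, p j⟫ / ‖p m‖ ^ 2) / 2) _ hzero, ← Finset.sum_div, Finset.sum_sub_distrib,
    ← Finset.sum_div, ← inner_sum, hsum]
  simp
end

section
/- Let n ≥ 2 and σ > 0, let p_1, …, p_n be pairwise distinct points in ℝ^d with Σ_{i=1}^n p_i = 0, and define q_i = p_i − σ Σ_{j ≠ i} (p_i − p_j)/‖p_i − p_j‖ for each i. If σ (n−1)² < Σ_{i=1}^n ‖p_i‖, then Σ_{i=1}^n ‖q_i‖² < Σ_{i=1}^n ‖p_i‖²; that is, the sum of squared distances of the agents from their (invariant) average decreases whenever the sum of their distances from the average exceeds σ(n−1)². -/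
open Finset

section

variable {ι E : Type*} [NormedAddCommGroup E]

lemma card_mul_norm_le_sum_norm_sub [Fintype ι] [NormedSpace ℝ E] (p : ι → E) (hsum : ∑ i, p i = 0) (i : ι) :
    (Fintype.card ι : ℝ) * ‖p i‖ ≤ ∑ j, ‖p i - p j‖ := by
  have h : ∑ j, (p i - p j) = (Fintype.card ι : ℝ) • p i := by
    rw [sum_sub_distrib, hsum, sub_zero, sum_const, card_univ, Nat.cast_smul_eq_nsmul]
  calc (Fintype.card ι : ℝ) * ‖p i‖ = ‖∑ j, (p i - p j)‖ := by
        rw [h, norm_smul, Real.norm_natCast]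
    _ ≤ ∑ j, ‖p i - p j‖ := norm_sum_le _ _

lemma norm_sum_inv_norm_smul_le [NormedSpace ℝ E] (s : Finset ι) (v : ι → E) :
    ‖∑ j ∈ s, ‖v j‖⁻¹ • v j‖ ≤ #s := by
  calc ‖∑ j ∈ s, ‖v j‖⁻¹ • v j‖ ≤ ∑ j ∈ s, (1 : ℝ) := by
        refine norm_sum_le_of_le _ fun j _ => ?_
        rw [norm_smul, norm_inv, norm_norm]
        exact inv_mul_le_one
    _ = #s := by simp

lemma two_mul_sum_inner_sum_inv_norm_smul_sub [Fintype ι] [InnerProductSpace ℝ E]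
    (p : ι → E) :
    2 * ∑ i, inner ℝ (p i) (∑ j, ‖p i - p j‖⁻¹ • (p i - p j)) = ∑ i, ∑ j, ‖p i - p j‖ := by
  simp only [inner_sum]
  rw [two_mul]
  nth_rewrite 2 [sum_comm]
  simp only [← sum_add_distrib]
  refine sum_congr rfl fun i _ => sum_congr rfl fun j _ => ?_
  rw [norm_sub_rev (p j) (p i), ← neg_sub (p i) (p j), smul_neg, inner_neg_right,
    ← sub_eq_add_neg, ← inner_sub_left, inner_smul_right, real_inner_self_eq_norm_sq]
  rcases eq_or_ne ‖p i - p j‖ 0 with h | h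
  · simp [h]
  · field_simp

end

/-- One step of system S4 strictly decreases the sum of squared distances
from the (zero) average as long as the sum of distances from the average
exceeds `σ(n-1)²`. -/
theorem S4_step_decrease {d n : ℕ} (hn : 2 ≤ n) (σ : ℝ) (hσ : 0 < σ)
    (p q : Fin n → EuclideanSpace ℝ (Fin d))
    (hdist : ∀ i j, i ≠ j → p i ≠ p j)
    (hsum : ∑ i, p i = 0)
    (hq : ∀ i, q i = p i
      - σ • ∑ j ∈ Finset.univ.erase i, (‖p i - p j‖)⁻¹ • (p i - p j))
    (hcond : σ * ((n : ℝ) - 1) ^ 2 < ∑ i, ‖p i‖) :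
    ∑ i, ‖q i‖ ^ 2 < ∑ i, ‖p i‖ ^ 2 := by
  set u : Fin n → EuclideanSpace ℝ (Fin d) := fun i => ∑ j, ‖p i - p j‖⁻¹ • (p i - p j) with hu
  have hue : ∀ i, ∑ j ∈ univ.erase i, ‖p i - p j‖⁻¹ • (p i - p j) = u i :=
    fun i => sum_erase _ (by simp)
  have hn0 : (0 : ℝ) < n := by exact_mod_cast (by lia : 0 < n)
  have hu_norm : ∀ i, ‖u i‖ ^ 2 ≤ ((n : ℝ) - 1) ^ 2 := fun i => by
    have h := norm_sum_inv_norm_smul_le (univ.erase i) fun j => p i - p j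
    rw [hue, card_erase_of_mem (mem_univ i), card_univ, Fintype.card_fin,
      Nat.cast_sub (by lia), Nat.cast_one] at h
    gcongr
  have hu_sum : ∑ i, ‖u i‖ ^ 2 ≤ n * ((n : ℝ) - 1) ^ 2 :=
    (sum_le_sum fun i _ => hu_norm i).trans_eq (by simp)
  have hdiff : n * ∑ i, ‖p i‖ ≤ ∑ i, ∑ j, ‖p i - p j‖ := by
    rw [mul_sum]
    exact sum_le_sum fun i _ => by simpa using card_mul_norm_le_sum_norm_sub p hsum i
  have hinner : 2 * ∑ i, inner ℝ (p i) (u i) = ∑ i, ∑ j, ‖p i - p j‖ :=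
    two_mul_sum_inner_sum_inv_norm_smul_sub p
  have hexpand : ∑ i, ‖q i‖ ^ 2 = ∑ i, ‖p i‖ ^ 2
      - σ * (2 * ∑ i, inner ℝ (p i) (u i) - σ * ∑ i, ‖u i‖ ^ 2) := by
    simp only [mul_sum, ← sum_sub_distrib]
    refine sum_congr rfl fun i _ => ?_
    rw [hq, hue, norm_sub_sq_real, inner_smul_right, norm_smul, mul_pow, Real.norm_eq_abs, sq_abs]
    ring
  have hpos : 0 < 2 * ∑ i, inner ℝ (p i) (u i) - σ * ∑ i, ‖u i‖ ^ 2 := by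
    have h₁ := mul_le_mul_of_nonneg_left hu_sum hσ.le
    have h₂ := mul_lt_mul_of_pos_left hcond hn0
    linarith
  rw [hexpand]
  linarith [mul_pos hσ hpos]
end

section
/- Let V > 0 and let p_i, p_j ∈ ℝ^d satisfy 0 < ‖p_i − p_j‖ ≤ V. Define c_ij = p_i + (V/2)·(p_j − p_i)/‖p_j − p_i‖ and c_ji = p_j + (V/2)·(p_i − p_j)/‖p_i − p_j‖. Suppose q_i ∈ ℝ^d satisfies ‖q_i − p_i‖ ≤ V/2 and ‖q_i − c_ij‖ ≤ V/2, and q_j ∈ ℝ^d satisfies ‖q_j − p_j‖ ≤ V/2 and ‖q_j − c_ji‖ ≤ V/2. Then ‖q_i − q_j‖ ≤ V; that is, if two mutually visible agents each move into their allowable regions, they remain within visibility range V of each other. -/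
/-- "Never lose a neighbour": if two mutually visible agents (at distance at
most `V`) each move into their allowable region — the intersection of the
disc of radius `V/2` around their own position with the disc of radius `V/2`
around the point at distance `V/2` towards the other agent — then they remain
within visibility range `V` of each other. -/
theorem allowable_region_keeps_visibility {d : ℕ} (V : ℝ) (hV : 0 < V)
    (pi pj qi qj : EuclideanSpace ℝ (Fin d))
    (hpos : 0 < ‖pi - pj‖) (hvis : ‖pi - pj‖ ≤ V)
    (hqi1 : ‖qi - pi‖ ≤ V / 2)
    (hqi2 : ‖qi - (pi + (V / 2) • (‖pj - pi‖)⁻¹ • (pj - pi))‖ ≤ V / 2)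
    (hqj1 : ‖qj - pj‖ ≤ V / 2)
    (hqj2 : ‖qj - (pj + (V / 2) • (‖pi - pj‖)⁻¹ • (pi - pj))‖ ≤ V / 2) :
    ‖qi - qj‖ ≤ V := by
  have hL : ‖pj - pi‖ = ‖pi - pj‖ := norm_sub_rev _ _
  rw [hL] at hqi2
  have hconv := convex_closedBall (0 : EuclideanSpace ℝ (Fin d)) V
  have hx : (qi - pi) - (qj - pj) ∈ Metric.closedBall (0 : EuclideanSpace ℝ (Fin d)) V := by
    rw [mem_closedBall_zero_iff]
    linarith [norm_sub_le (qi - pi) (qj - pj)]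
  have hy : (qi - (pi + (V / 2) • (‖pi - pj‖)⁻¹ • (pj - pi))) -
      (qj - (pj + (V / 2) • (‖pi - pj‖)⁻¹ • (pi - pj))) ∈
      Metric.closedBall (0 : EuclideanSpace ℝ (Fin d)) V := by
    rw [mem_closedBall_zero_iff]
    exact (norm_sub_le _ _).trans (by linarith)
  have h := hconv hx hy (a := 1 - ‖pi - pj‖ / V) (b := ‖pi - pj‖ / V)
    (sub_nonneg.mpr ((div_le_one hV).mpr hvis)) (by positivity) (by ring)
  rw [mem_closedBall_zero_iff] at h
  refine le_of_eq_of_le (congrArg norm ?_) h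
  have hV' := hV.ne'
  have hpos' := hpos.ne'
  generalize ‖pi - pj‖ = L at hpos'
  match_scalars <;> field_simp <;> ring
end

section
/- Let n ≥ 1, let p_1, …, p_n ∈ ℝ^d with average p̄ = (1/n) Σ_i p_i, fix an index s and a displacement vector Δ ∈ ℝ^d, and define q_i = p_i for i ≠ s and q_s = p_s + Δ, with average q̄ = (1/n) Σ_i q_i. Then Σ_{i=1}^n ‖q_i − q̄‖² − Σ_{i=1}^n ‖p_i − p̄‖² = ‖Δ‖² + 2⟨Δ, p_s − p̄⟩ − ‖Δ‖²/n; in particular, if ‖q_s − p̄‖ < ‖p_s − p̄‖ (the moving agent gets strictly closer to the old average), then Σ_i ‖q_i − q̄‖² − Σ_i ‖p_i − p̄‖² < −‖Δ‖²/n. -/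
open Finset
open scoped RealInnerProductSpace

/-- The sum of squared distances to the average, in terms of the sum of squared norms and the
norm of the sum. -/
lemma sum_norm_sub_average_sq {ι E : Type*} [Fintype ι] [NormedAddCommGroup E]
    [InnerProductSpace ℝ E] (p : ι → E) :
    ∑ i, ‖p i - (Fintype.card ι : ℝ)⁻¹ • ∑ j, p j‖ ^ 2
      = ∑ i, ‖p i‖ ^ 2 - (Fintype.card ι : ℝ)⁻¹ * ‖∑ j, p j‖ ^ 2 := by
  simp only [norm_sub_sq_real, sum_add_distrib, sum_sub_distrib, ← mul_sum, ← sum_inner,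
    inner_smul_right, real_inner_self_eq_norm_sq, sum_const, card_univ, nsmul_eq_mul,
    norm_smul, mul_pow, Real.norm_eq_abs, sq_abs]
  rcases eq_or_ne (Fintype.card ι : ℝ) 0 with h | h
  · simp [h]
  · field_simp
    ring

/-- Changing a family at a single index changes a sum over the family by one difference. -/
lemma sum_sub_sum_eq_of_eq_off {ι M α : Type*} [Fintype ι] [AddCommGroup M] {p q : ι → α} {s : ι}
    (hq : ∀ i, i ≠ s → q i = p i) (f : α → M) :
    ∑ i, f (q i) - ∑ i, f (p i) = f (q s) - f (p s) := by
  rw [← sum_sub_distrib]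
  exact Fintype.sum_eq_single s fun i hi => by rw [hq i hi, sub_self]

/-- Change of the Lyapunov function `Σ_i ‖p_i - p̄‖²` when exactly one agent
`s` moves by `Δ` while all other agents stay put; in particular, if the moving
agent gets strictly closer to the old average, the Lyapunov function drops by
more than `‖Δ‖²/n`. -/
theorem single_agent_move_lyapunov {d n : ℕ} (hn : 1 ≤ n)
    (p q : Fin n → EuclideanSpace ℝ (Fin d))
    (s : Fin n) (Δ : EuclideanSpace ℝ (Fin d))
    (hqs : q s = p s + Δ) (hq : ∀ i, i ≠ s → q i = p i) :
    (∑ i, ‖q i - (n : ℝ)⁻¹ • ∑ j, q j‖ ^ 2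
        - ∑ i, ‖p i - (n : ℝ)⁻¹ • ∑ j, p j‖ ^ 2
      = ‖Δ‖ ^ 2 + 2 * ⟪Δ, p s - (n : ℝ)⁻¹ • ∑ j, p j⟫ - ‖Δ‖ ^ 2 / n) ∧
    (‖q s - (n : ℝ)⁻¹ • ∑ j, p j‖ < ‖p s - (n : ℝ)⁻¹ • ∑ j, p j‖ →
      ∑ i, ‖q i - (n : ℝ)⁻¹ • ∑ j, q j‖ ^ 2
          - ∑ i, ‖p i - (n : ℝ)⁻¹ • ∑ j, p j‖ ^ 2
        < -(‖Δ‖ ^ 2 / n)) := by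
  have hsum : ∑ j, q j = ∑ j, p j + Δ := by
    have h := sum_sub_sum_eq_of_eq_off hq id
    simp only [id, hqs, add_sub_cancel_left] at h
    rw [← h, add_sub_cancel]
  have hsq : ∑ i, ‖q i‖ ^ 2 - ∑ i, ‖p i‖ ^ 2 = 2 * ⟪p s, Δ⟫ + ‖Δ‖ ^ 2 := by
    rw [sum_sub_sum_eq_of_eq_off hq (‖·‖ ^ 2), hqs, norm_add_sq_real]
    ring
  have key : ∑ i, ‖q i - (n : ℝ)⁻¹ • ∑ j, q j‖ ^ 2
        - ∑ i, ‖p i - (n : ℝ)⁻¹ • ∑ j, p j‖ ^ 2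
      = ‖Δ‖ ^ 2 + 2 * ⟪Δ, p s - (n : ℝ)⁻¹ • ∑ j, p j⟫ - ‖Δ‖ ^ 2 / n := by
    have hp := sum_norm_sub_average_sq p
    have hq_sum := sum_norm_sub_average_sq q
    rw [Fintype.card_fin] at hp hq_sum
    rw [hp, hq_sum, hsum, norm_add_sq_real, inner_sub_right, inner_smul_right,
      real_inner_comm (p s) Δ, real_inner_comm (∑ j, p j) Δ]
    linear_combination hsq
  refine ⟨key, fun hlt => ?_⟩
  have hlt2 := pow_lt_pow_left₀ hlt (norm_nonneg _) two_ne_zero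
  rw [hqs, add_sub_right_comm, norm_add_sq_real, real_inner_comm] at hlt2
  rw [key]
  linarith
end
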